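/- arXiv:1412.5142 — 2 statements merged into one kernel-verified Lean document; each statement's English description precedes it below -/
import Mathlib

section
/- Let D₁, D₂ ⊆ ℂ be domains, let F₁, F₃ be analytic on D₁ and F₂, F₄ be analytic on D₂, and set Π_ζ = {ζ ∈ E₃ : ξ₁ ∈ D₁ and ξ₂ ∈ D₂}. Then the mapping Φ(ζ) = F₁(ξ₁)e₁ + F₂(ξ₂)e₂ + F₃(ξ₁)e₃ + F₄(ξ₂)e₄ is right-G-monogenic in Π_ζ, with right Gateaux derivative Φ′(ζ) = F₁′(ξ₁)e₁ + F₂′(ξ₂)e₂ + F₃′(ξ₁)e₃ + F₄′(ξ₂)e₄; and the mapping Φ̂(ζ) = F₁(ξ₁)e₁ + F₂(ξ₂)e₂ + F₃(ξ₂)e₃ + F₄(ξ₁)e₄ (with F₃ analytic on D₂ and F₄ analytic on D₁) is left-G-monogenic in Π_ζ, with left Gateaux derivative Φ̂′(ζ) = F₁′(ξ₁)e₁ + F₂′(ξ₂)e₂ + F₃′(ξ₂)e₃ + F₄′(ξ₁)e₄. -/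
open Filter Set Topology Quaternion

noncomputable section

abbrev HC : Type := ℍ[ℂ, -1, -1]

/-- The idempotent `e₁ = (1 + iI)/2`. -/
def e1 : HC := ⟨1/2, Complex.I/2, 0, 0⟩
/-- The idempotent `e₂ = (1 - iI)/2`. -/
def e2 : HC := ⟨1/2, -(Complex.I/2), 0, 0⟩
/-- `e₃ = (iJ - K)/2`. -/
def e3 : HC := ⟨0, 0, Complex.I/2, -(1/2)⟩
/-- `e₄ = (iJ + K)/2`. -/
def e4 : HC := ⟨0, 0, Complex.I/2, 1/2⟩

/-- Topology on `ℍ(ℂ)` induced from the four complex coordinates. -/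
instance : TopologicalSpace HC :=
  TopologicalSpace.induced (fun q : HC => (q.re, q.imI, q.imJ, q.imK)) inferInstance

/-- Coordinate of `a ∈ ℍ(ℂ)` at `e₁` in the basis `{e₁, e₂, e₃, e₄}`. -/
def c1 (a : HC) : ℂ := a.re - Complex.I * a.imI
/-- Coordinate at `e₂`. -/
def c2 (a : HC) : ℂ := a.re + Complex.I * a.imI
/-- Coordinate at `e₃`. -/
def c3 (a : HC) : ℂ := -(Complex.I * a.imJ) - a.imK
/-- Coordinate at `e₄`. -/
def c4 (a : HC) : ℂ := -(Complex.I * a.imJ) + a.imK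

/-- The norm `‖a‖ = √(|a₁|² + |a₂|² + |a₃|² + |a₄|²)`, coordinates in the basis `{e₁,e₂,e₃,e₄}`. -/
def qnorm (a : HC) : ℝ :=
  Real.sqrt (‖c1 a‖ ^ 2 + ‖c2 a‖ ^ 2 +
    ‖c3 a‖ ^ 2 + ‖c4 a‖ ^ 2)

/-- `f₁ : ℍ(ℂ) → ℂ`, the ℂ-linear functional with `f₁(e₁) = f₁(e₃) = 1`, `f₁(e₂) = f₁(e₄) = 0`. -/
def f1 (a : HC) : ℂ := c1 a + c3 a
/-- `f₂ : ℍ(ℂ) → ℂ`, with `f₂(e₂) = f₂(e₄) = 1`, `f₂(e₁) = f₂(e₃) = 0`. -/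
def f2 (a : HC) : ℂ := c2 a + c4 a
/-- `f̂₁ : ℍ(ℂ) → ℂ`, with `f̂₁(e₁) = f̂₁(e₄) = 1`, `f̂₁(e₂) = f̂₁(e₃) = 0`. -/
def fh1 (a : HC) : ℂ := c1 a + c4 a
/-- `f̂₂ : ℍ(ℂ) → ℂ`, with `f̂₂(e₂) = f̂₂(e₃) = 1`, `f̂₂(e₁) = f̂₂(e₄) = 0`. -/
def fh2 (a : HC) : ℂ := c2 a + c3 a

/-- `ζ = x i₁ + y i₂ + z i₃` for `p = (x, y, z) ∈ ℝ³` (with `i₁ = 1`). -/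
def zeta (i2 i3 : HC) (p : ℝ × ℝ × ℝ) : HC :=
  (p.1 : ℂ) • (1 : HC) + (p.2.1 : ℂ) • i2 + (p.2.2 : ℂ) • i3

/-- The real linear span `E₃` of `i₁ = 1, i₂, i₃`. -/
def E3 (i2 i3 : HC) : Set HC := Set.range (zeta i2 i3)

/-- `i₁ = 1, i₂, i₃` are linearly independent over `ℝ`. -/
def LinIndep (i2 i3 : HC) : Prop :=
  ∀ α₁ α₂ α₃ : ℝ, (α₁ : ℂ) • (1 : HC) + (α₂ : ℂ) • i2 + (α₃ : ℂ) • i3 = 0 →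
    α₁ = 0 ∧ α₂ = 0 ∧ α₃ = 0

/-- `Φ` is right-G-monogenic on `S` (w.r.t. directions in `E₃`): it is continuous on `S` and at
every `ζ ∈ S` there is `Φ'(ζ)` with `lim_{ε→0+} (Φ(ζ+εh) − Φ(ζ))ε⁻¹ = h·Φ'(ζ)` for all `h ∈ E₃`. -/
def RightGMonogenic (i2 i3 : HC) (Φ : HC → HC) (S : Set HC) : Prop :=
  ContinuousOn Φ S ∧ ∀ ζ ∈ S, ∃ Φ' : HC, ∀ h ∈ E3 i2 i3,
    Tendsto (fun ε : ℝ => ((ε : ℂ))⁻¹ • (Φ (ζ + (ε : ℂ) • h) - Φ ζ))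
      (nhdsWithin 0 (Set.Ioi 0)) (nhds (h * Φ'))

/-- `Φ̂` is left-G-monogenic on `S`. -/
def LeftGMonogenic (i2 i3 : HC) (Φ : HC → HC) (S : Set HC) : Prop :=
  ContinuousOn Φ S ∧ ∀ ζ ∈ S, ∃ Φ' : HC, ∀ h ∈ E3 i2 i3,
    Tendsto (fun ε : ℝ => ((ε : ℂ))⁻¹ • (Φ (ζ + (ε : ℂ) • h) - Φ ζ))
      (nhdsWithin 0 (Set.Ioi 0)) (nhds (Φ' * h))

/-- The right maximal ideal `𝓘₁ = {λ₂e₂ + λ₄e₄}`. -/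
def I1 : Set HC := {a | ∃ l2 l4 : ℂ, a = l2 • e2 + l4 • e4}
/-- The right maximal ideal `𝓘₂ = {λ₁e₁ + λ₃e₃}`. -/
def I2 : Set HC := {a | ∃ l1 l3 : ℂ, a = l1 • e1 + l3 • e3}
/-- The left maximal ideal `𝓘̂₁ = {λ₂e₂ + λ₃e₃}`. -/
def Ih1 : Set HC := {a | ∃ l2 l3 : ℂ, a = l2 • e2 + l3 • e3}
/-- The left maximal ideal `𝓘̂₂ = {λ₁e₁ + λ₄e₄}`. -/
def Ih2 : Set HC := {a | ∃ l1 l4 : ℂ, a = l1 • e1 + l4 • e4}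

/-- The line `L` in `ℝ³` given by `x + y·Re a + z·Re b = 0`, `y·Im a + z·Im b = 0`. -/
def lineL (a b : ℂ) : Set (ℝ × ℝ × ℝ) :=
  {p | p.1 + p.2.1 * a.re + p.2.2 * b.re = 0 ∧ p.2.1 * a.im + p.2.2 * b.im = 0}

/-- `Ω` is convex in the direction of the line `L` (a line through the origin): it contains every
segment parallel to `L` joining two of its points. -/
def ConvexInDirection (Ω : Set (ℝ × ℝ × ℝ)) (L : Set (ℝ × ℝ × ℝ)) : Prop :=
  ∀ p ∈ Ω, ∀ q ∈ Ω, q - p ∈ L → segment ℝ p q ⊆ Ω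

/-- `ξ = x + y·a + z·b` for `p = (x,y,z)`. -/
def xi (a b : ℂ) (p : ℝ × ℝ × ℝ) : ℂ := (p.1 : ℂ) + (p.2.1 : ℂ) * a + (p.2.2 : ℂ) * b


/-- `Φ'` is a right Gateaux derivative of `Φ` on `S` (directions in `E₃`). -/
def IsRightGDeriv (i2 i3 : HC) (Φ Φ' : HC → HC) (S : Set HC) : Prop :=
  ∀ ζ ∈ S, ∀ h ∈ E3 i2 i3,
    Tendsto (fun ε : ℝ => ((ε : ℂ))⁻¹ • (Φ (ζ + (ε : ℂ) • h) - Φ ζ))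
      (nhdsWithin 0 (Set.Ioi 0)) (nhds (h * Φ' ζ))

/-- `Φ'` is a left Gateaux derivative of `Φ` on `S`. -/
def IsLeftGDeriv (i2 i3 : HC) (Φ Φ' : HC → HC) (S : Set HC) : Prop :=
  ∀ ζ ∈ S, ∀ h ∈ E3 i2 i3,
    Tendsto (fun ε : ℝ => ((ε : ℂ))⁻¹ • (Φ (ζ + (ε : ℂ) • h) - Φ ζ))
      (nhdsWithin 0 (Set.Ioi 0)) (nhds (Φ' ζ * h))

/-- Triples `(α, β, γ)` of naturals with `α + β + γ = n`. -/
def trip (n : ℕ) : Finset (ℕ × ℕ × ℕ) :=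
  (Finset.range (n + 1) ×ˢ Finset.range (n + 1) ×ˢ Finset.range (n + 1)).filter
    (fun u => u.1 + u.2.1 + u.2.2 = n)

/-- The combination of the basis elements with given coefficients. -/
def comb (w : ℂ × ℂ × ℂ × ℂ) : HC := w.1 • e1 + w.2.1 • e2 + w.2.2.1 • e3 + w.2.2.2 • e4

theorem continuous_comb : Continuous comb := by
  refine continuous_induced_rng.2 ?_
  simp only [Function.comp_def, comb, e1, e2, e3, e4, QuaternionAlgebra.re_add,
    QuaternionAlgebra.imI_add, QuaternionAlgebra.imJ_add, QuaternionAlgebra.imK_add,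
    QuaternionAlgebra.re_smul, QuaternionAlgebra.imI_smul, QuaternionAlgebra.imJ_smul,
    QuaternionAlgebra.imK_smul, smul_eq_mul]
  fun_prop

theorem continuous_coords :
    Continuous (fun q : HC => (q.re, q.imI, q.imJ, q.imK)) := continuous_induced_dom

theorem continuous_f1 : Continuous f1 := by
  have h : Continuous (fun w : ℂ × ℂ × ℂ × ℂ =>
    w.1 - Complex.I * w.2.1 + (-(Complex.I * w.2.2.1) - w.2.2.2)) := by fun_prop
  exact h.comp continuous_coords

theorem continuous_f2 : Continuous f2 := by
  have h : Continuous (fun w : ℂ × ℂ × ℂ × ℂ =>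
    w.1 + Complex.I * w.2.1 + (-(Complex.I * w.2.2.1) + w.2.2.2)) := by fun_prop
  exact h.comp continuous_coords

theorem f1_add_smul (ζ h : HC) (c : ℂ) : f1 (ζ + c • h) = f1 ζ + c * f1 h := by
  simp [f1, c1, c3]; ring

theorem f2_add_smul (ζ h : HC) (c : ℂ) : f2 (ζ + c • h) = f2 ζ + c * f2 h := by
  simp [f2, c2, c4]; ring

theorem f1_comb (w : ℂ × ℂ × ℂ × ℂ) : f1 (comb w) = w.1 + w.2.2.1 := by
  simp [f1, c1, c3, comb, e1, e2, e3, e4]; ring_nf; simp; ring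

theorem f2_comb (w : ℂ × ℂ × ℂ × ℂ) : f2 (comb w) = w.2.1 + w.2.2.2 := by
  simp [f2, c2, c4, comb, e1, e2, e3, e4]; ring_nf; simp; ring

theorem comb_mul (u v : ℂ) (w : ℂ × ℂ × ℂ × ℂ) :
    comb (u, v, 0, 0) * comb w = comb (u * w.1, v * w.2.1, u * w.2.2.1, v * w.2.2.2) := by
  ext <;> simp [comb, e1, e2, e3, e4] <;> ring_nf <;> simp <;> ring

theorem mul_comb (u v : ℂ) (w : ℂ × ℂ × ℂ × ℂ) :
    comb w * comb (u, v, 0, 0) = comb (u * w.1, v * w.2.1, v * w.2.2.1, u * w.2.2.2) := by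
  ext <;> simp [comb, e1, e2, e3, e4] <;> ring_nf <;> simp <;> ring

theorem comb_sub (c : ℂ) (w w' : ℂ × ℂ × ℂ × ℂ) :
    c • (comb w - comb w') = comb (c • (w - w')) := by
  simp only [comb, Prod.smul_fst, Prod.smul_snd, Prod.fst_sub, Prod.snd_sub, smul_eq_mul]
  module

theorem mem_E3 (a₁ a₂ b₁ b₂ : ℂ) {h : HC}
    (hh : h ∈ E3 (a₁ • e1 + a₂ • e2) (b₁ • e1 + b₂ • e2)) :
    h = comb (f1 h, f2 h, 0, 0) := by
  obtain ⟨p, rfl⟩ := hh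
  have key : zeta (a₁ • e1 + a₂ • e2) (b₁ • e1 + b₂ • e2) p =
      comb (p.1 + p.2.1 * a₁ + p.2.2 * b₁, p.1 + p.2.1 * a₂ + p.2.2 * b₂, 0, 0) := by
    have one : (1 : HC) = e1 + e2 := by
      ext <;> simp [e1, e2] <;> norm_num
    simp only [zeta, comb, one]
    module
  rw [key, f1_comb, f2_comb]
  simp

theorem tendsto_quot {F : ℂ → ℂ} {D : Set ℂ} (hF : AnalyticOnNhd ℂ F D) {z : ℂ} (hz : z ∈ D)
    (c : ℂ) : Tendsto (fun ε : ℝ => (ε : ℂ)⁻¹ * (F (z + (ε : ℂ) * c) - F z))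
      (nhdsWithin 0 (Set.Ioi 0)) (nhds (c * deriv F z)) := by
  have h1 : HasDerivAt F (deriv F z) (z + ((0 : ℝ) : ℂ) * c) := by
    simpa using (hF z hz).differentiableAt.hasDerivAt
  have h2 : HasDerivAt (fun ε : ℝ => z + (ε : ℂ) * c) c 0 := by
    simpa using ((Complex.ofRealCLM.hasDerivAt (x := (0 : ℝ))).mul_const c).const_add z
  have h3 := (h1.comp (0 : ℝ) h2).tendsto_slope_zero_right
  simpa [Function.comp_def, mul_comm c] using h3

/-- for analytic `F₁, F₃` on `D₁` and `F₂, F₄` on `D₂`, the map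
`F₁(ξ₁)e₁ + F₂(ξ₂)e₂ + F₃(ξ₁)e₃ + F₄(ξ₂)e₄` is right-G-monogenic in
`Π_ζ = {ζ ∈ E₃ : ξ₁ ∈ D₁, ξ₂ ∈ D₂}` with derivative `F₁′(ξ₁)e₁ + F₂′(ξ₂)e₂ + F₃′(ξ₁)e₃ + F₄′(ξ₂)e₄`;
and (for `G₃` analytic on `D₂`, `G₄` on `D₁`) `G₁(ξ₁)e₁ + G₂(ξ₂)e₂ + G₃(ξ₂)e₃ + G₄(ξ₁)e₄` is
left-G-monogenic in `Π_ζ` with the analogous left Gateaux derivative. -/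
theorem statement14 (a₁ a₂ b₁ b₂ : ℂ) (i2 i3 : HC)
    (hi2 : i2 = a₁ • e1 + a₂ • e2) (hi3 : i3 = b₁ • e1 + b₂ • e2)
    (hLI : LinIndep i2 i3)
    (D1 D2 : Set ℂ) (hD1o : IsOpen D1) (hD1c : IsPreconnected D1)
    (hD2o : IsOpen D2) (hD2c : IsPreconnected D2)
    (F1 F2 F3 F4 G1 G2 G3 G4 : ℂ → ℂ)
    (hF1 : AnalyticOnNhd ℂ F1 D1) (hF3 : AnalyticOnNhd ℂ F3 D1)
    (hF2 : AnalyticOnNhd ℂ F2 D2) (hF4 : AnalyticOnNhd ℂ F4 D2)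
    (hG1 : AnalyticOnNhd ℂ G1 D1) (hG4 : AnalyticOnNhd ℂ G4 D1)
    (hG2 : AnalyticOnNhd ℂ G2 D2) (hG3 : AnalyticOnNhd ℂ G3 D2) :
    (ContinuousOn
        (fun ζ : HC => F1 (f1 ζ) • e1 + F2 (f2 ζ) • e2 + F3 (f1 ζ) • e3 + F4 (f2 ζ) • e4)
        {ζ ∈ E3 i2 i3 | f1 ζ ∈ D1 ∧ f2 ζ ∈ D2} ∧
      IsRightGDeriv i2 i3
        (fun ζ : HC => F1 (f1 ζ) • e1 + F2 (f2 ζ) • e2 + F3 (f1 ζ) • e3 + F4 (f2 ζ) • e4)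
        (fun ζ : HC => deriv F1 (f1 ζ) • e1 + deriv F2 (f2 ζ) • e2 +
          deriv F3 (f1 ζ) • e3 + deriv F4 (f2 ζ) • e4)
        {ζ ∈ E3 i2 i3 | f1 ζ ∈ D1 ∧ f2 ζ ∈ D2}) ∧
    (ContinuousOn
        (fun ζ : HC => G1 (f1 ζ) • e1 + G2 (f2 ζ) • e2 + G3 (f2 ζ) • e3 + G4 (f1 ζ) • e4)
        {ζ ∈ E3 i2 i3 | f1 ζ ∈ D1 ∧ f2 ζ ∈ D2} ∧
      IsLeftGDeriv i2 i3
        (fun ζ : HC => G1 (f1 ζ) • e1 + G2 (f2 ζ) • e2 + G3 (f2 ζ) • e3 + G4 (f1 ζ) • e4)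
        (fun ζ : HC => deriv G1 (f1 ζ) • e1 + deriv G2 (f2 ζ) • e2 +
          deriv G3 (f2 ζ) • e3 + deriv G4 (f1 ζ) • e4)
        {ζ ∈ E3 i2 i3 | f1 ζ ∈ D1 ∧ f2 ζ ∈ D2}) := by
  subst hi2 hi3
  have c1' : Continuous f1 := continuous_f1
  have c2' : Continuous f2 := continuous_f2
  refine ⟨⟨?_, ?_⟩, ⟨?_, ?_⟩⟩
  · refine continuous_comb.comp_continuousOn
      (f := fun ζ => (F1 (f1 ζ), F2 (f2 ζ), F3 (f1 ζ), F4 (f2 ζ))) ?_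
    exact (hF1.continuousOn.comp c1'.continuousOn fun ζ hζ => hζ.2.1).prodMk
      ((hF2.continuousOn.comp c2'.continuousOn fun ζ hζ => hζ.2.2).prodMk
      ((hF3.continuousOn.comp c1'.continuousOn fun ζ hζ => hζ.2.1).prodMk
      (hF4.continuousOn.comp c2'.continuousOn fun ζ hζ => hζ.2.2)))
  · intro ζ hζ h hh
    have H := (continuous_comb.tendsto _).comp ((tendsto_quot hF1 hζ.2.1 (f1 h)).prodMk_nhds
      ((tendsto_quot hF2 hζ.2.2 (f2 h)).prodMk_nhds
      ((tendsto_quot hF3 hζ.2.1 (f1 h)).prodMk_nhds (tendsto_quot hF4 hζ.2.2 (f2 h)))))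
    have e : h * comb (deriv F1 (f1 ζ), deriv F2 (f2 ζ), deriv F3 (f1 ζ), deriv F4 (f2 ζ)) =
        comb (f1 h * deriv F1 (f1 ζ), f2 h * deriv F2 (f2 ζ), f1 h * deriv F3 (f1 ζ),
          f2 h * deriv F4 (f2 ζ)) := by
      conv_lhs => rw [mem_E3 _ _ _ _ hh]
      exact comb_mul _ _ _
    rw [← e] at H
    refine H.congr fun ε => ?_
    simp only [← f1_add_smul, ← f2_add_smul]
    exact (comb_sub _ (F1 (f1 (ζ + (ε : ℂ) • h)), F2 (f2 (ζ + (ε : ℂ) • h)),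
      F3 (f1 (ζ + (ε : ℂ) • h)), F4 (f2 (ζ + (ε : ℂ) • h)))
      (F1 (f1 ζ), F2 (f2 ζ), F3 (f1 ζ), F4 (f2 ζ))).symm
  · refine continuous_comb.comp_continuousOn
      (f := fun ζ => (G1 (f1 ζ), G2 (f2 ζ), G3 (f2 ζ), G4 (f1 ζ))) ?_
    exact (hG1.continuousOn.comp c1'.continuousOn fun ζ hζ => hζ.2.1).prodMk
      ((hG2.continuousOn.comp c2'.continuousOn fun ζ hζ => hζ.2.2).prodMk
      ((hG3.continuousOn.comp c2'.continuousOn fun ζ hζ => hζ.2.2).prodMk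
      (hG4.continuousOn.comp c1'.continuousOn fun ζ hζ => hζ.2.1)))
  · intro ζ hζ h hh
    have H := (continuous_comb.tendsto _).comp ((tendsto_quot hG1 hζ.2.1 (f1 h)).prodMk_nhds
      ((tendsto_quot hG2 hζ.2.2 (f2 h)).prodMk_nhds
      ((tendsto_quot hG3 hζ.2.2 (f2 h)).prodMk_nhds (tendsto_quot hG4 hζ.2.1 (f1 h)))))
    have e : comb (deriv G1 (f1 ζ), deriv G2 (f2 ζ), deriv G3 (f2 ζ), deriv G4 (f1 ζ)) * h =
        comb (f1 h * deriv G1 (f1 ζ), f2 h * deriv G2 (f2 ζ), f2 h * deriv G3 (f2 ζ),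
          f1 h * deriv G4 (f1 ζ)) := by
      conv_lhs => rw [mem_E3 _ _ _ _ hh]
      exact mul_comb _ _ _
    rw [← e] at H
    refine H.congr fun ε => ?_
    simp only [← f1_add_smul, ← f2_add_smul]
    exact (comb_sub _ (G1 (f1 (ζ + (ε : ℂ) • h)), G2 (f2 (ζ + (ε : ℂ) • h)),
      G3 (f2 (ζ + (ε : ℂ) • h)), G4 (f1 (ζ + (ε : ℂ) • h)))
      (G1 (f1 ζ), G2 (f2 ζ), G3 (f2 ζ), G4 (f1 ζ))).symm

end
end

section
/- Let n ∈ ℕ and let real coefficients C_{α,β,γ} be given for all α, β, γ ∈ ℕ with α + β + γ = n, and define P(a,b) = Σ_{α+β+γ=n} C_{α,β,γ} aᵝ bᵞ. Suppose ℍ(ℂ) contains a triple i₁ = 1, i₂ = a₁e₁ + a₂e₂, i₃ = b₁e₁ + b₂e₂ (a₁, a₂, b₁, b₂ ∈ ℂ) that is linearly independent over ℝ and satisfies the characteristic equation Σ_{α+β+γ=n} C_{α,β,γ} i₂ᵝ i₃ᵞ = 0. If P(a,b) ≠ 0 for all real a, b, then for each k ∈ {1, 2} at least one of the numbers aₖ,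 bₖ belongs to ℂ∖ℝ (equivalently, f₁(E₃) = f₂(E₃) = ℂ). -/
open Filter Set Topology Quaternion

noncomputable section

theorem D_mul (x y z w : ℂ) :
    (x • e1 + y • e2 : HC) * (z • e1 + w • e2) = (x * z) • e1 + (y * w) • e2 := by
  have hI := Complex.I_mul_I
  ext <;> simp [e1, e2] <;> grind

theorem D_one : (1 : HC) = (1 : ℂ) • e1 + (1 : ℂ) • e2 := by
  ext <;> simp [e1, e2]; norm_num

theorem D_pow (x y : ℂ) (k : ℕ) :
    (x • e1 + y • e2 : HC) ^ k = (x ^ k) • e1 + (y ^ k) • e2 := by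
  induction k with
  | zero => simpa using D_one
  | succ k ih => rw [pow_succ, ih, D_mul, pow_succ, pow_succ]

/-- `c1` as a linear map. -/
def c1L : HC →ₗ[ℂ] ℂ where
  toFun := c1
  map_add' x y := by simp [c1]; ring
  map_smul' x y := by simp [c1]; ring

/-- `c2` as a linear map. -/
def c2L : HC →ₗ[ℂ] ℂ where
  toFun := c2
  map_add' x y := by simp [c2]; ring
  map_smul' x y := by simp [c2]; ring

theorem c1L_D (x y : ℂ) : c1L (x • e1 + y • e2) = x := by
  have hI := Complex.I_mul_I
  simp [c1L, c1, e1, e2]; grind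

theorem c2L_D (x y : ℂ) : c2L (x • e1 + y • e2) = y := by
  have hI := Complex.I_mul_I
  simp [c2L, c2, e1, e2]; grind

/-- Theorem 9: if a linearly independent triple `1, i₂, i₃` satisfies the
characteristic equation `Σ C_{α,β,γ} i₂^β i₃^γ = 0` and `P(a,b) ≠ 0` for all real `a, b`, then in
each pair `(a₁, b₁)`, `(a₂, b₂)` at least one number lies in `ℂ∖ℝ`. -/
theorem statement17 (n : ℕ) (C : ℕ → ℕ → ℕ → ℝ)
    (a₁ a₂ b₁ b₂ : ℂ) (i2 i3 : HC)
    (hi2 : i2 = a₁ • e1 + a₂ • e2) (hi3 : i3 = b₁ • e1 + b₂ • e2)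
    (hLI : LinIndep i2 i3)
    (hchar : ∑ u ∈ trip n, ((C u.1 u.2.1 u.2.2 : ℝ) : ℂ) • (i2 ^ u.2.1 * i3 ^ u.2.2) = (0 : HC))
    (hP : ∀ a b : ℝ, ∑ u ∈ trip n, C u.1 u.2.1 u.2.2 * a ^ u.2.1 * b ^ u.2.2 ≠ 0) :
    (a₁ ∉ Set.range ((↑) : ℝ → ℂ) ∨ b₁ ∉ Set.range ((↑) : ℝ → ℂ)) ∧
    (a₂ ∉ Set.range ((↑) : ℝ → ℂ) ∨ b₂ ∉ Set.range ((↑) : ℝ → ℂ)) := by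
  subst hi2 hi3
  simp only [D_pow, D_mul] at hchar
  constructor
  · by_contra! hcon
    obtain ⟨⟨a, rfl⟩, ⟨b, rfl⟩⟩ := hcon
    have h := congrArg c1L hchar
    simp only [map_sum, map_smul, c1L_D, map_zero, smul_eq_mul] at h
    apply hP a b
    simp only [mul_assoc]
    exact_mod_cast h
  · by_contra! hcon
    obtain ⟨⟨a, rfl⟩, ⟨b, rfl⟩⟩ := hcon
    have h := congrArg c2L hchar
    simp only [map_sum, map_smul, c2L_D, map_zero, smul_eq_mul] at h
    apply hP a b
    simp only [mul_assoc]
    exact_mod_cast h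

end
end
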